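/- For every τ₀ ∈ (0,1) there exists a constant C = C(τ₀) > 0 such that for all τ ∈ (0, τ₀) and all x ∈ ℝ, the derivative of F_τ satisfies |F_τ'(x)| ≤ C(1 + x²). -/

import Mathlib

/-- The flow `Φ_t(x) = x / √(x² + (1 − x²)·exp(−2t))` of the ODE `x' = x − x³`. -/
noncomputable def Phi (t x : ℝ) : ℝ :=
  x / Real.sqrt (x ^ 2 + (1 - x ^ 2) * Real.exp (-2 * t))

/-- `F_τ(x) = (Φ_τ(x) − x)/τ`. -/
noncomputable def Ftau (τ x : ℝ) : ℝ := (Phi τ x - x) / τ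

/-- The radicand in `Phi` is positive. -/
lemma radicand_pos {e : ℝ} (he : 0 < e) (he1 : e < 1) (x : ℝ) :
    0 < x ^ 2 + (1 - x ^ 2) * e := by
  nlinarith [mul_nonneg (sq_nonneg x) (sub_nonneg.2 he1.le)]

/-- The spatial derivative of the flow is `exp(-2t) / √(x² + (1 − x²)·exp(−2t))³`. -/
lemma hasDerivAt_Phi {t : ℝ} (ht : 0 < t) (x : ℝ) :
    HasDerivAt (Phi t)
      (Real.exp (-2 * t) / Real.sqrt (x ^ 2 + (1 - x ^ 2) * Real.exp (-2 * t)) ^ 3) x := by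
  have hpos := radicand_pos (Real.exp_pos (-2 * t)) (Real.exp_lt_one_iff.2 (by linarith)) x
  unfold Phi
  set e := Real.exp (-2 * t)
  have hs := Real.sqrt_pos.2 hpos
  have hsq := Real.sq_sqrt hpos.le
  have hx2 : HasDerivAt (fun y : ℝ => y ^ 2) (2 * x) x := by
    simpa using hasDerivAt_pow 2 x
  have hD : HasDerivAt (fun y : ℝ => y ^ 2 + (1 - y ^ 2) * e) (2 * x + -(2 * x) * e) x :=
    hx2.add ((hx2.const_sub 1).mul_const e)
  refine ((hasDerivAt_id x).div (hD.sqrt hpos.ne') hs.ne').congr_deriv ?_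
  simp only [id]
  set s := Real.sqrt (x ^ 2 + (1 - x ^ 2) * e)
  field_simp
  linear_combination hsq

/-- The spatial derivative of the flow differs from `1` by at most `4 t (1 + x²)`. -/
lemma abs_deriv_Phi_sub_one_le {t : ℝ} (ht : 0 < t) (ht1 : t < 1) (x : ℝ) :
    |Real.exp (-2 * t) / Real.sqrt (x ^ 2 + (1 - x ^ 2) * Real.exp (-2 * t)) ^ 3 - 1|
      ≤ 4 * t * (1 + x ^ 2) := by
  have he1 : Real.exp (-2 * t) < 1 := Real.exp_lt_one_iff.2 (by linarith)
  have he2 : 1 - 2 * t ≤ Real.exp (-2 * t) := by linarith [Real.add_one_le_exp (-2 * t)]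
  have he0 := Real.exp_pos (-2 * t)
  have hpos := radicand_pos he0 he1 x
  have heq : Real.exp (-2 * t) = Real.exp (-t) ^ 2 := by
    rw [← Real.exp_nat_mul]
    congr 1
    push_cast
    ring
  have hpq : Real.exp t * Real.exp (-t) = 1 := by rw [← Real.exp_add]; simp
  have hq0 := Real.exp_pos (-t)
  have hp0 := Real.exp_pos t
  have hp : Real.exp t ≤ 1 + 3 * t := by
    have hp3 : Real.exp t < 3 :=
      (Real.exp_lt_exp.2 ht1).trans (by linarith [Real.exp_one_lt_d9])
    nlinarith [Real.add_one_le_exp (-t)]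
  set e := Real.exp (-2 * t)
  have hs := Real.sqrt_pos.2 hpos
  have hsq := Real.sq_sqrt hpos.le
  have hqs : Real.exp (-t) ≤ Real.sqrt (x ^ 2 + (1 - x ^ 2) * e) := by
    apply Real.le_sqrt_of_sq_le
    nlinarith [mul_nonneg (sq_nonneg x) (sub_nonneg.2 he1.le)]
  set s := Real.sqrt (x ^ 2 + (1 - x ^ 2) * e)
  have hs3 : 0 < s ^ 3 := by positivity
  have htx : 0 ≤ t * x ^ 2 := by positivity
  have upper : e / s ^ 3 ≤ Real.exp t := by
    rw [div_le_iff₀ hs3]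
    calc e = Real.exp t * Real.exp (-t) ^ 3 := by
          rw [heq]
          linear_combination (-Real.exp (-t) ^ 2) * hpq
      _ ≤ Real.exp t * s ^ 3 := by gcongr
  have lower : 1 - 2 * t - 4 * t * x ^ 2 ≤ e / s ^ 3 := by
    rcases le_total s 1 with h | h
    · have : e ≤ e / s ^ 3 := le_div_self he0.le hs3 (pow_le_one₀ hs.le h)
      linarith
    · have hδ : s ^ 2 - 1 ≤ 2 * t * x ^ 2 := by
        rw [hsq]
        nlinarith [mul_nonneg (sq_nonneg x) (by linarith : 0 ≤ e - (1 - 2 * t))]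
      have hs2 : 0 ≤ s ^ 2 - 1 := by nlinarith
      have inv_bound : 1 - 2 * (s ^ 2 - 1) ≤ 1 / s ^ 3 := by
        calc 1 - 2 * (s ^ 2 - 1) ≤ 1 / s ^ 4 := by
              rw [le_div_iff₀ (by positivity)]
              nlinarith [mul_nonneg (sq_nonneg (s ^ 2 - 1)) (by linarith : 0 ≤ 2 * s ^ 2 + 1)]
          _ ≤ 1 / s ^ 3 := by
              apply one_div_le_one_div_of_le hs3
              exact pow_le_pow_right₀ h (by norm_num)
      have := mul_le_mul_of_nonneg_left inv_bound he0.le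
      rw [mul_one_div] at this
      nlinarith [mul_nonneg hs2 (sub_nonneg.2 he1.le)]
  rw [abs_le]
  constructor <;> nlinarith

/-- `|F_τ'(x)| ≤ C(1 + x²)` uniformly for `τ ∈ (0, τ₀)`. -/
theorem Ftau_deriv_growth (τ₀ : ℝ) (hτ₀ : τ₀ ∈ Set.Ioo (0 : ℝ) 1) :
    ∃ C : ℝ, 0 < C ∧ ∀ τ ∈ Set.Ioo (0 : ℝ) τ₀, ∀ x : ℝ,
      |deriv (fun y => Ftau τ y) x| ≤ C * (1 + x ^ 2) := by
  refine ⟨4, by norm_num, fun τ hτ x => ?_⟩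
  have hτ0 : 0 < τ := hτ.1
  have hd : HasDerivAt (fun y => Ftau τ y) _ x :=
    ((hasDerivAt_Phi hτ0 x).sub (hasDerivAt_id x)).div_const τ
  rw [hd.deriv, abs_div, abs_of_pos hτ0, div_le_iff₀ hτ0]
  linarith [abs_deriv_Phi_sub_one_le hτ0 (hτ.2.trans hτ₀.2) x]
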